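/- arXiv:2407.19769 — 2 statements merged into one kernel-verified Lean document; each statement's English description precedes it below -/
import Mathlib

section
/- Let λ, μ be real numbers, let R ∈ M₃(ℝ) be an orthogonal matrix, and let Ω ⊆ ℝ³ be an open set invariant under R (R(Ω) = Ω). Let u, v : ℝ³ → ℝ³ be continuously differentiable on Ω with the function x ↦ λ div u(x) div v(x) + 2μ ⟨e(u)(x), e(v)(x)⟩ integrable over Ω. Suppose u is R-equivariant and v is R-anti-equivariant on Ω, i.e. u(Rx) = R u(x) and v(Rx) = −R v(x) for all x ∈ Ω. Then ∫_Ω [λ div u div v + 2μ ⟨e(u), e(v)⟩] dx = 0. -/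
open MeasureTheory

/-- The divergence `div u` of a vector field `u : ℝ³ → ℝ³`. -/
noncomputable def vdiv (u : (Fin 3 → ℝ) → (Fin 3 → ℝ)) (x : Fin 3 → ℝ) : ℝ :=
  ∑ k, fderiv ℝ u x (Pi.single k 1) k

/-- The strain tensor `e(u) = ½(∇u + (∇u)ᵀ)`. -/
noncomputable def strain (u : (Fin 3 → ℝ) → (Fin 3 → ℝ)) (x : Fin 3 → ℝ) (i j : Fin 3) : ℝ :=
  (fderiv ℝ u x (Pi.single j 1) i + fderiv ℝ u x (Pi.single i 1) j) / 2

/-- The cross elastic energy density `λ div u div v + 2μ ⟨e(u), e(v)⟩`, with `⟨·,·⟩` the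
Frobenius inner product. -/
noncomputable def crossDensity (lam mu : ℝ) (u v : (Fin 3 → ℝ) → (Fin 3 → ℝ))
    (x : Fin 3 → ℝ) : ℝ :=
  lam * vdiv u x * vdiv v x + 2 * mu * ∑ i, ∑ j, strain u x i j * strain v x i j

/-- The Jacobian matrix. -/
noncomputable def jacMat (u : (Fin 3 → ℝ) → (Fin 3 → ℝ)) (x : Fin 3 → ℝ) :
    Matrix (Fin 3) (Fin 3) ℝ := LinearMap.toMatrix' (fderiv ℝ u x : (Fin 3 → ℝ) →ₗ[ℝ] (Fin 3 → ℝ))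

lemma jacMat_apply (u : (Fin 3 → ℝ) → (Fin 3 → ℝ)) (x : Fin 3 → ℝ) (i j : Fin 3) :
    jacMat u x i j = fderiv ℝ u x (Pi.single j 1) i := by
  simp [jacMat, LinearMap.toMatrix'_apply]

lemma crossDensity_eq (lam mu : ℝ) (u v : (Fin 3 → ℝ) → (Fin 3 → ℝ)) (x : Fin 3 → ℝ) :
    crossDensity lam mu u v x = lam * (jacMat u x).trace * (jacMat v x).trace +
      2 * mu * ((1 / 4) * ((jacMat u x + (jacMat u x).transpose) *
        (jacMat v x + (jacMat v x).transpose)).trace) := by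
  simp only [crossDensity, vdiv, strain, Matrix.trace, Matrix.diag, Matrix.mul_apply,
    Matrix.add_apply, Matrix.transpose_apply, ← jacMat_apply, Fin.sum_univ_three]
  ring

lemma jacMat_equi (c : ℝ) (R : Matrix (Fin 3) (Fin 3) ℝ) (hR : R.transpose * R = 1)
    (Ω : Set (Fin 3 → ℝ)) (hopen : IsOpen Ω) (hinv : R.mulVec '' Ω = Ω)
    (u : (Fin 3 → ℝ) → (Fin 3 → ℝ)) (hu : ContDiffOn ℝ 1 u Ω)
    (h : ∀ x ∈ Ω, u (R.mulVec x) = c • R.mulVec (u x)) (x : Fin 3 → ℝ) (hx : x ∈ Ω) :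
    jacMat u (R.mulVec x) = c • (R * jacMat u x * R.transpose) := by
  have hd : ∀ y ∈ Ω, DifferentiableAt ℝ u y := fun y hy =>
    (hu.differentiableOn one_ne_zero).differentiableAt (hopen.mem_nhds hy)
  let L : (Fin 3 → ℝ) →L[ℝ] (Fin 3 → ℝ) := LinearMap.toContinuousLinearMap (Matrix.toLin' R)
  have hL : ∀ y, L y = R.mulVec y := fun y => by simp [L]
  have hRx : L x ∈ Ω := by rw [hL, ← hinv]; exact ⟨x, hx, rfl⟩
  have h1 : HasFDerivAt (fun y => u (L y)) ((fderiv ℝ u (L x)).comp L) x :=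
    (hd _ hRx).hasFDerivAt.comp x L.hasFDerivAt
  have h2 : HasFDerivAt (fun y => c • L (u y)) (c • L.comp (fderiv ℝ u x)) x :=
    (L.hasFDerivAt.comp x (hd _ hx).hasFDerivAt).const_smul c
  have h3 : HasFDerivAt (fun y => u (L y)) (c • L.comp (fderiv ℝ u x)) x := by
    refine h2.congr_of_eventuallyEq ?_
    filter_upwards [hopen.mem_nhds hx] with y hy
    simp only [hL]
    exact h y hy
  have h4 := h1.unique h3
  have hLm : LinearMap.toMatrix' (L : (Fin 3 → ℝ) →ₗ[ℝ] (Fin 3 → ℝ)) = R := by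
    simp [L]
  have h5 : jacMat u (R.mulVec x) * R = c • (R * jacMat u x) := by
    have := congrArg (fun T : (Fin 3 → ℝ) →L[ℝ] (Fin 3 → ℝ) =>
      LinearMap.toMatrix' (T : (Fin 3 → ℝ) →ₗ[ℝ] (Fin 3 → ℝ))) h4
    simpa [LinearMap.toMatrix'_comp, hLm, jacMat, hL] using this
  have hR' : R * R.transpose = 1 := mul_eq_one_comm.mp hR
  rw [← Matrix.smul_mul, ← h5, Matrix.mul_assoc, hR', Matrix.mul_one]

lemma crossDensity_anti (lam mu : ℝ) (R : Matrix (Fin 3) (Fin 3) ℝ) (hR : R.transpose * R = 1)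
    (u v : (Fin 3 → ℝ) → (Fin 3 → ℝ)) (x : Fin 3 → ℝ)
    (hu : jacMat u (R.mulVec x) = (1 : ℝ) • (R * jacMat u x * R.transpose))
    (hv : jacMat v (R.mulVec x) = (-1 : ℝ) • (R * jacMat v x * R.transpose)) :
    crossDensity lam mu u v (R.mulVec x) = - crossDensity lam mu u v x := by
  have ht : ∀ A : Matrix (Fin 3) (Fin 3) ℝ, (R * A * R.transpose).trace = A.trace := fun A => by
    rw [Matrix.trace_mul_comm, ← Matrix.mul_assoc, hR, Matrix.one_mul]
  have hs : ∀ A : Matrix (Fin 3) (Fin 3) ℝ, R * A * R.transpose + (R * A * R.transpose).transpose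
      = R * (A + A.transpose) * R.transpose := fun A => by
    simp [Matrix.transpose_mul, Matrix.mul_add, Matrix.add_mul, Matrix.mul_assoc]
  have hm : ∀ A B : Matrix (Fin 3) (Fin 3) ℝ, (R * A * R.transpose) * (R * B * R.transpose)
      = R * (A * B) * R.transpose := fun A B => by
    calc _ = R * A * (R.transpose * R) * B * R.transpose := by simp only [Matrix.mul_assoc]
      _ = _ := by rw [hR]; simp only [Matrix.mul_assoc, Matrix.one_mul]
  rw [crossDensity_eq, crossDensity_eq, hu, hv, Matrix.transpose_smul, Matrix.transpose_smul,
    ← smul_add, ← smul_add, hs, hs, Matrix.smul_mul, Matrix.mul_smul, hm]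
  simp only [Matrix.trace_smul, ht, smul_eq_mul]
  ring

/-- On an open set `Ω` invariant under an orthogonal matrix `R`, the cross
elastic energy of an `R`-equivariant field `u` and an `R`-anti-equivariant field `v`
vanishes. -/
theorem stmt4 (lam mu : ℝ) (R : Matrix (Fin 3) (Fin 3) ℝ) (hR : R.transpose * R = 1)
    (Ω : Set (Fin 3 → ℝ)) (hopen : IsOpen Ω) (hinv : R.mulVec '' Ω = Ω)
    (u v : (Fin 3 → ℝ) → (Fin 3 → ℝ))
    (hu : ContDiffOn ℝ 1 u Ω) (hv : ContDiffOn ℝ 1 v Ω)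
    (hint : IntegrableOn (fun x => crossDensity lam mu u v x) Ω volume)
    (hequi : ∀ x ∈ Ω, u (R.mulVec x) = R.mulVec (u x))
    (hanti : ∀ x ∈ Ω, v (R.mulVec x) = -(R.mulVec (v x))) :
    ∫ x in Ω, crossDensity lam mu u v x = 0 := by
  have hanti' : ∀ x ∈ Ω, crossDensity lam mu u v (R.mulVec x) = - crossDensity lam mu u v x :=
    fun x hx => crossDensity_anti lam mu R hR u v x
      (jacMat_equi 1 R hR Ω hopen hinv u hu (fun y hy => by rw [hequi y hy, one_smul]) x hx)
      (jacMat_equi (-1) R hR Ω hopen hinv v hv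
        (fun y hy => by rw [hanti y hy, neg_one_smul]) x hx)
  let L : (Fin 3 → ℝ) →L[ℝ] (Fin 3 → ℝ) := LinearMap.toContinuousLinearMap (Matrix.toLin' R)
  have hL : ∀ y, L y = R.mulVec y := fun y => by simp [L]
  have hLf : (L : (Fin 3 → ℝ) → (Fin 3 → ℝ)) = R.mulVec := funext hL
  have hinj : Set.InjOn R.mulVec Ω := fun a _ b _ hab => by
    have := congrArg R.transpose.mulVec hab
    simpa [Matrix.mulVec_mulVec, hR] using this
  have hdet : |L.det| = 1 := by
    have h1 : L.det = R.det := by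
      simp [L, ContinuousLinearMap.det]
    have h2 : R.det * R.det = 1 := by
      have := congrArg Matrix.det hR
      simpa [Matrix.det_mul, Matrix.det_transpose] using this
    rw [h1]
    rcases mul_self_eq_one_iff.mp h2 with h | h <;> simp [h]
  have key := integral_image_eq_integral_abs_det_fderiv_smul volume hopen.measurableSet
    (f := R.mulVec) (f' := fun _ => L)
    (fun x _ => by rw [← hLf]; exact L.hasFDerivWithinAt) hinj (crossDensity lam mu u v)
  rw [hinv] at key
  have key2 : ∫ x in Ω, |L.det| • crossDensity lam mu u v (R.mulVec x)
      = ∫ x in Ω, - crossDensity lam mu u v x :=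
    setIntegral_congr_fun hopen.measurableSet (fun x hx => by
      simp only [hdet, one_smul]; exact hanti' x hx)
  rw [key2, integral_neg] at key
  linarith
end

section
/- Let p, q, r, s, t, u be real numbers and let M be the 4×4 real matrix with entries M₁₁ = M₃₃ = p, M₂₂ = M₄₄ = r, M₁₃ = M₃₁ = q, M₂₄ = M₄₂ = s, M₁₂ = M₂₁ = t, M₃₄ = M₄₃ = −t, M₁₄ = M₄₁ = u, M₂₃ = M₃₂ = −u. Then the characteristic polynomial of M factors as char(M)(X) = (X² − (p − q + r + s)X + (p − q)(r + s) − (t + u)²) · (X² − (p + q + r − s)X + (p + q)(r − s) − (t − u)²). -/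
open Polynomial

/-- The characteristic polynomial of the structured `4 × 4` matrix
`M` (with `M₁₁ = M₃₃ = p`, `M₂₂ = M₄₄ = r`, `M₁₃ = M₃₁ = q`, `M₂₄ = M₄₂ = s`,
`M₁₂ = M₂₁ = t = −M₃₄ = −M₄₃`, `M₁₄ = M₄₁ = u = −M₂₃ = −M₃₂`) factors as the product of
two quadratics. -/
theorem stmt8 (p q r s t u : ℝ) :
    (!![p, t, q, u;
        t, r, -u, s;
        q, -u, p, -t;
        u, s, -t, r] : Matrix (Fin 4) (Fin 4) ℝ).charpoly =
      (X ^ 2 - C (p - q + r + s) * X + C ((p - q) * (r + s) - (t + u) ^ 2)) *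
        (X ^ 2 - C (p + q + r - s) * X + C ((p + q) * (r - s) - (t - u) ^ 2)) := by
  rw [Matrix.charpoly, Matrix.det_succ_row_zero]
  simp [Fin.sum_univ_succ, Matrix.det_fin_three, Matrix.charmatrix_apply, Matrix.submatrix_apply,
    Fin.succAbove, Matrix.diagonal_apply]
  ring
end
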